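/- arXiv:0809.1992 — 8 statements merged into one kernel-verified Lean document; each statement's English description precedes it below -/
import Mathlib

section
/- Let m ≥ 1, u ∈ ℝᵐ and t = |u|², and suppose α(t)φ(t) ≠ 0, α₁(t)·(α₁+α₃)(t) ≠ 0 and φ₁(t)·(φ₁+φ₃)(t) ≠ 0. Then the matrix μ(α₁(t),β₁(t),u) is invertible and μ((α₁+α₃)(t),(β₁+β₃)(t),u) − μ(α₂(t),β₂(t),u)·μ(α₁(t),β₁(t),u)⁻¹·μ(α₂(t),β₂(t),u) = μ(λ₁,λ₂,u), where λ₁ = α(t)/α₁(t) and λ₂ = [φ₁(t)·(α₁(t)(β₁+β₃)(t) − α₂(t)β₂(t) − φ₂(t)β₂(t)) + β₁(t)·φ₂(t)²]/(α₁(t)·φ₁(t)). -/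
open Matrix

/-- The `m × m` real matrix with `(i,j)` entry `a·δᵢⱼ + b·uⁱuʲ`. -/
def mu {m : ℕ} (a b : ℝ) (u : Fin m → ℝ) : Matrix (Fin m) (Fin m) ℝ :=
  Matrix.of fun i j => a * (if i = j then (1 : ℝ) else 0) + b * u i * u j

theorem mu_mul_mu {m : ℕ} (a b c d : ℝ) (u : Fin m → ℝ) :
    mu a b u * mu c d u = mu (a * c) (a * d + b * c + (∑ i, u i ^ 2) * (b * d)) u := by
  have mu_eq (a b : ℝ) : mu a b u = a • (1 : Matrix (Fin m) (Fin m) ℝ) + b • vecMulVec u u := by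
    ext i j
    simp [mu, Matrix.one_apply, vecMulVec_apply, mul_assoc]
  have hsq : vecMulVec u u * vecMulVec u u = (∑ i, u i ^ 2) • vecMulVec u u := by
    ext i j
    simp only [Matrix.mul_apply, vecMulVec_apply, Matrix.smul_apply, smul_eq_mul, Finset.sum_mul]
    exact Finset.sum_congr rfl fun k _ => by ring
  simp only [mu_eq, add_mul, mul_add, smul_mul_assoc, mul_smul_comm, one_mul, mul_one, hsq]
  module

theorem mu_one_zero {m : ℕ} (u : Fin m → ℝ) : mu 1 0 u = 1 := by
  ext i j
  simp [mu, Matrix.one_apply]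

theorem mu_sub_mu {m : ℕ} (a b c d : ℝ) (u : Fin m → ℝ) :
    mu a b u - mu c d u = mu (a - c) (b - d) u := by
  ext i j
  simp only [mu, Matrix.sub_apply, Matrix.of_apply]
  ring

theorem mu_mul_mu_inv {m : ℕ} (a b : ℝ) (u : Fin m → ℝ) (ha : a ≠ 0)
    (hφ : a + (∑ i, u i ^ 2) * b ≠ 0) :
    mu a b u * mu a⁻¹ (-b / (a * (a + (∑ i, u i ^ 2) * b))) u = 1 := by
  rw [mu_mul_mu, ← mu_one_zero u]
  generalize ∑ i, u i ^ 2 = s at hφ ⊢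
  congr 1
  · exact mul_inv_cancel₀ ha
  · generalize hp : a + s * b = p at hφ ⊢
    field_simp
    linear_combination (-b) * hp

theorem stmt1 (m : ℕ) (hm : 1 ≤ m) (α₁ α₂ α₃ β₁ β₂ β₃ : ℝ → ℝ)
    (u : Fin m → ℝ) (t : ℝ) (ht : t = ∑ i, u i ^ 2)
    (φ₁ φ₂ φ₃ A Φ : ℝ)
    (hφ₁ : φ₁ = α₁ t + t * β₁ t) (hφ₂ : φ₂ = α₂ t + t * β₂ t)
    (hφ₃ : φ₃ = α₃ t + t * β₃ t)
    (hA : A = α₁ t * (α₁ t + α₃ t) - α₂ t ^ 2)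
    (hΦ : Φ = φ₁ * (φ₁ + φ₃) - φ₂ ^ 2)
    (h1 : A * Φ ≠ 0) (h2 : α₁ t * (α₁ t + α₃ t) ≠ 0)
    (h3 : φ₁ * (φ₁ + φ₃) ≠ 0)
    (lam₁ lam₂ : ℝ)
    (hlam₁ : lam₁ = A / α₁ t)
    (hlam₂ : lam₂ = (φ₁ * (α₁ t * (β₁ t + β₃ t) - α₂ t * β₂ t - φ₂ * β₂ t)
        + β₁ t * φ₂ ^ 2) / (α₁ t * φ₁)) :
    IsUnit (mu (α₁ t) (β₁ t) u) ∧
      mu (α₁ t + α₃ t) (β₁ t + β₃ t) u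
          - mu (α₂ t) (β₂ t) u * (mu (α₁ t) (β₁ t) u)⁻¹ * mu (α₂ t) (β₂ t) u
        = mu lam₁ lam₂ u := by
  have ha : α₁ t ≠ 0 := left_ne_zero_of_mul h2
  have hφ : φ₁ ≠ 0 := left_ne_zero_of_mul h3
  have hinv := mu_mul_mu_inv (α₁ t) (β₁ t) u ha (by rwa [← ht, ← hφ₁])
  refine ⟨IsUnit.of_mul_eq_one _ hinv, ?_⟩
  rw [Matrix.inv_eq_right_inv hinv, mu_mul_mu, mu_mul_mu, mu_sub_mu, ← ht, ← hφ₁, hlam₁, hlam₂, hA]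
  congr 1
  · field_simp
  · subst hφ₂
    field_simp
    ring
end

section
/- Let m ≥ 1, u ∈ ℝᵐ and t = |u|², and suppose α(t)φ(t) ≠ 0, α₁(t)·(α₁+α₃)(t) ≠ 0 and φ₁(t)·(φ₁+φ₃)(t) ≠ 0. Then the 2m×2m block matrix G = [[μ((α₁+α₃)(t),(β₁+β₃)(t),u), μ(α₂(t),β₂(t),u)], [μ(α₂(t),β₂(t),u), μ(α₁(t),β₁(t),u)]] is invertible, and its inverse is the block matrix [[Λ, Θ], [Θ, Ω]] whose blocks have entries Λᵢⱼ = (α₁(t)/α(t))·δᵢⱼ − ψ_λ(t)·uⁱuʲ, Θᵢⱼ = −(α₂(t)/α(t))·δᵢⱼ − ψ_θ(t)·uⁱuʲ, and Ωᵢⱼ = ((α₁+α₃)(t)/α(t))·δᵢⱼ − ψ_ω(t)·uⁱuʲ. -/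
open Matrix

theorem mu_add {m : ℕ} (a b c d : ℝ) (u : Fin m → ℝ) :
    mu a b u + mu c d u = mu (a + c) (b + d) u := by
  ext i j
  simp only [mu, Matrix.add_apply, Matrix.of_apply]
  ring

theorem mu_eq_smul_add {m : ℕ} (a b : ℝ) (u : Fin m → ℝ) :
    mu a b u = a • (1 : Matrix (Fin m) (Fin m) ℝ) + b • Matrix.vecMulVec u u := by
  ext i j
  simp [mu, Matrix.one_apply, Matrix.vecMulVec_apply, mul_assoc]

theorem mu_mul {m : ℕ} (a b c d : ℝ) (u : Fin m → ℝ) :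
    mu a b u * mu c d u = mu (a * c) (a * d + b * c + b * d * ∑ i, u i ^ 2) u := by
  have hsq : Matrix.vecMulVec u u * Matrix.vecMulVec u u
      = (∑ i, u i ^ 2) • Matrix.vecMulVec u u := by
    ext i j
    simp only [Matrix.mul_apply, Matrix.vecMulVec_apply, Matrix.smul_apply, smul_eq_mul,
      Finset.sum_mul]
    exact Finset.sum_congr rfl fun k _ => by ring
  simp only [mu_eq_smul_add, add_mul, mul_add, smul_mul_assoc, mul_smul_comm, one_mul, mul_one,
    hsq]
  module

theorem mu_zero_zero {m : ℕ} (u : Fin m → ℝ) : mu 0 0 u = 0 := by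
  simp [mu_eq_smul_add]

theorem stmt7 (m : ℕ) (hm : 1 ≤ m) (α₁ α₂ α₃ β₁ β₂ β₃ : ℝ → ℝ)
    (u : Fin m → ℝ) (t : ℝ) (ht : t = ∑ i, u i ^ 2)
    (φ₁ φ₂ φ₃ A Φ : ℝ)
    (hφ₁ : φ₁ = α₁ t + t * β₁ t) (hφ₂ : φ₂ = α₂ t + t * β₂ t)
    (hφ₃ : φ₃ = α₃ t + t * β₃ t)
    (hA : A = α₁ t * (α₁ t + α₃ t) - α₂ t ^ 2)
    (hΦ : Φ = φ₁ * (φ₁ + φ₃) - φ₂ ^ 2)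
    (h1 : A * Φ ≠ 0) (h2 : α₁ t * (α₁ t + α₃ t) ≠ 0)
    (h3 : φ₁ * (φ₁ + φ₃) ≠ 0)
    (ψlam ψθ ψom : ℝ)
    (hψlam : ψlam = (α₁ t * ((β₁ t + β₃ t) * φ₁ - β₂ t * φ₂)
        - α₂ t * (α₁ t * β₂ t - α₂ t * β₁ t)) / (A * Φ))
    (hψθ : ψθ = (-(α₂ t) * ((β₁ t + β₃ t) * φ₁ - β₂ t * φ₂)
        + (α₁ t + α₃ t) * (α₁ t * β₂ t - α₂ t * β₁ t)) / (A * Φ))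
    (hψom : ψom = ((α₁ t + α₃ t) * (β₁ t * (φ₁ + φ₃) - β₂ t * φ₂)
        + α₂ t * (α₂ t * (β₁ t + β₃ t) - β₂ t * (α₁ t + α₃ t))) / (A * Φ))
    (G : Matrix (Fin m ⊕ Fin m) (Fin m ⊕ Fin m) ℝ)
    (hG : G = Matrix.fromBlocks
      (mu (α₁ t + α₃ t) (β₁ t + β₃ t) u) (mu (α₂ t) (β₂ t) u)
      (mu (α₂ t) (β₂ t) u) (mu (α₁ t) (β₁ t) u))
    (Lam Θ Ω : Matrix (Fin m) (Fin m) ℝ)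
    (hLam : ∀ i j, Lam i j =
      α₁ t / A * (if i = j then (1 : ℝ) else 0) - ψlam * u i * u j)
    (hΘ : ∀ i j, Θ i j =
      -(α₂ t / A) * (if i = j then (1 : ℝ) else 0) - ψθ * u i * u j)
    (hΩ : ∀ i j, Ω i j =
      (α₁ t + α₃ t) / A * (if i = j then (1 : ℝ) else 0) - ψom * u i * u j) :
    IsUnit G ∧ G⁻¹ = Matrix.fromBlocks Lam Θ Θ Ω := by
  have hLam' : Lam = mu (α₁ t / A) (-ψlam) u := by
    ext i j
    rw [hLam, mu, Matrix.of_apply]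
    ring
  have hΘ' : Θ = mu (-(α₂ t / A)) (-ψθ) u := by
    ext i j
    rw [hΘ, mu, Matrix.of_apply]
    ring
  have hΩ' : Ω = mu ((α₁ t + α₃ t) / A) (-ψom) u := by
    ext i j
    rw [hΩ, mu, Matrix.of_apply]
    ring
  obtain ⟨hA0, hΦ0⟩ := mul_ne_zero_iff.mp h1
  have key : G * Matrix.fromBlocks Lam Θ Θ Ω = 1 := by
    rw [hG, hLam', hΘ', hΩ', Matrix.fromBlocks_multiply, ← Matrix.fromBlocks_one]
    simp only [mu_mul, mu_add, ← ht]
    rw [← mu_one_zero u, ← mu_zero_zero u, hψlam, hψθ, hψom]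
    generalize α₁ t = a₁ at *
    generalize α₂ t = a₂ at *
    generalize α₃ t = a₃ at *
    generalize β₁ t = b₁ at *
    generalize β₂ t = b₂ at *
    generalize β₃ t = b₃ at *
    congr 2 <;> field_simp <;> simp only [hΦ, hA, hφ₁, hφ₂, hφ₃] <;> ring
  exact ⟨IsUnit.of_mul_eq_one _ key, Matrix.inv_eq_right_inv key⟩
end

section
/- Let m ≥ 1, let g be a symmetric positive definite m×m real matrix with inverse g⁻¹, let u ∈ ℝᵐ, set v = g·u and t = uᵀ·g·u, and suppose α(t)·φ(t) ≠ 0. Then the product of the 2m×2m block matrices [[(α₁+α₃)(t)·g + (β₁+β₃)(t)·v·vᵀ, α₂(t)·g + β₂(t)·v·vᵀ], [α₂(t)·g + β₂(t)·v·vᵀ, α₁(t)·g + β₁(t)·v·vᵀ]] and [[(α₁(t)/α(t))·g⁻¹ − ψ_λ(t)·u·uᵀ, −(α₂(t)/α(t))·g⁻¹ − ψ_θ(t)·u·uᵀ], [−(α₂(t)/α(t))·g⁻¹ − ψ_θ(t)·u·uᵀ, ((α₁+α₃)(t)/α(t))·g⁻¹ − ψ_ω(t)·u·uᵀ]] is the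 2m×2m identity matrix; in particular the first block matrix is invertible with the second as its inverse. -/
open Matrix

theorem Matrix.smul_add_vecMulVec_mul_smul_inv_sub_vecMulVec {n R : Type*} [Fintype n] [DecidableEq n]
    [CommRing R] (g : Matrix n n R) (hdet : IsUnit g.det) (hsymm : gᵀ = g) (u : n → R)
    (a b c d : R) :
    (a • g + b • vecMulVec (g *ᵥ u) (g *ᵥ u)) * (c • g⁻¹ - d • vecMulVec u u) =
      (a * c) • (1 : Matrix n n R) +
        (b * c - a * d - b * d * (u ⬝ᵥ g *ᵥ u)) • vecMulVec (g *ᵥ u) u := by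
  have hinv : (g *ᵥ u) ᵥ* g⁻¹ = u := by
    rw [← vecMul_transpose, hsymm, vecMul_vecMul, mul_nonsing_inv g hdet, vecMul_one]
  simp only [add_mul, mul_sub, smul_mul_assoc, mul_smul_comm, mul_nonsing_inv g hdet,
    vecMulVec_mul, mul_vecMulVec, vecMulVec_mulVec, hinv, op_smul_eq_smul, smul_vecMulVec,
    dotProduct_comm (g *ᵥ u) u]
  module

theorem stmt9 (m : ℕ) (hm : 1 ≤ m) (α₁ α₂ α₃ β₁ β₂ β₃ : ℝ → ℝ)
    (g : Matrix (Fin m) (Fin m) ℝ) (hg : g.PosDef)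
    (u v : Fin m → ℝ) (hv : v = g.mulVec u)
    (t : ℝ) (ht : t = u ⬝ᵥ g.mulVec u)
    (φ₁ φ₂ φ₃ A Φ : ℝ)
    (hφ₁ : φ₁ = α₁ t + t * β₁ t) (hφ₂ : φ₂ = α₂ t + t * β₂ t)
    (hφ₃ : φ₃ = α₃ t + t * β₃ t)
    (hA : A = α₁ t * (α₁ t + α₃ t) - α₂ t ^ 2)
    (hΦ : Φ = φ₁ * (φ₁ + φ₃) - φ₂ ^ 2)
    (h : A * Φ ≠ 0)
    (ψlam ψθ ψom : ℝ)
    (hψlam : ψlam = (α₁ t * ((β₁ t + β₃ t) * φ₁ - β₂ t * φ₂)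
        - α₂ t * (α₁ t * β₂ t - α₂ t * β₁ t)) / (A * Φ))
    (hψθ : ψθ = (-(α₂ t) * ((β₁ t + β₃ t) * φ₁ - β₂ t * φ₂)
        + (α₁ t + α₃ t) * (α₁ t * β₂ t - α₂ t * β₁ t)) / (A * Φ))
    (hψom : ψom = ((α₁ t + α₃ t) * (β₁ t * (φ₁ + φ₃) - β₂ t * φ₂)
        + α₂ t * (α₂ t * (β₁ t + β₃ t) - β₂ t * (α₁ t + α₃ t))) / (A * Φ))
    (G₁ G₂ : Matrix (Fin m ⊕ Fin m) (Fin m ⊕ Fin m) ℝ)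
    (hG₁ : G₁ = Matrix.fromBlocks
      ((α₁ t + α₃ t) • g + (β₁ t + β₃ t) • vecMulVec v v)
      (α₂ t • g + β₂ t • vecMulVec v v)
      (α₂ t • g + β₂ t • vecMulVec v v)
      (α₁ t • g + β₁ t • vecMulVec v v))
    (hG₂ : G₂ = Matrix.fromBlocks
      ((α₁ t / A) • g⁻¹ - ψlam • vecMulVec u u)
      (-(α₂ t / A) • g⁻¹ - ψθ • vecMulVec u u)
      (-(α₂ t / A) • g⁻¹ - ψθ • vecMulVec u u)
      (((α₁ t + α₃ t) / A) • g⁻¹ - ψom • vecMulVec u u)) :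
    G₁ * G₂ = 1 ∧ IsUnit G₁ ∧ G₁⁻¹ = G₂ := by
  have hdet : IsUnit g.det := hg.det_pos.ne'.isUnit
  have hsymm : gᵀ = g := by simpa using hg.isHermitian.eq
  have hA0 : A ≠ 0 := left_ne_zero_of_mul h
  have hΦ0 : Φ ≠ 0 := right_ne_zero_of_mul h
  have hmul : G₁ * G₂ = 1 := by
    rw [hG₁, hG₂, fromBlocks_multiply, ← fromBlocks_one]
    subst hv
    simp only [smul_add_vecMulVec_mul_smul_inv_sub_vecMulVec g hdet hsymm, ← ht]
    have combine (a b c d : ℝ) (M : Matrix (Fin m) (Fin m) ℝ) :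
        a • (1 : Matrix (Fin m) (Fin m) ℝ) + b • M + (c • 1 + d • M) =
          (a + c) • 1 + (b + d) • M := by module
    simp only [combine]
    generalize α₁ t = a₁ at *
    generalize α₂ t = a₂ at *
    generalize α₃ t = a₃ at *
    generalize β₁ t = b₁ at *
    generalize β₂ t = b₂ at *
    generalize β₃ t = b₃ at *
    have of_coeffs (x y : ℝ) (M : Matrix (Fin m) (Fin m) ℝ) (z : ℝ) (hx : x = z) (hy : y = 0) :
        x • (1 : Matrix (Fin m) (Fin m) ℝ) + y • M = z • 1 := by
      rw [hx, hy, zero_smul, add_zero]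
    congr 1
    · rw [← one_smul ℝ (1 : Matrix (Fin m) (Fin m) ℝ)]
      simp only [smul_smul, mul_one]
      apply of_coeffs
      · field_simp; rw [hA]; ring
      · rw [hψlam, hψθ]; field_simp; rw [hΦ, hA, hφ₁, hφ₂, hφ₃]; ring
    · rw [← zero_smul ℝ (1 : Matrix (Fin m) (Fin m) ℝ)]
      apply of_coeffs
      · field_simp; ring
      · rw [hψom, hψθ]; field_simp; rw [hΦ, hφ₁, hφ₂, hφ₃]; ring
    · rw [← zero_smul ℝ (1 : Matrix (Fin m) (Fin m) ℝ)]
      apply of_coeffs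
      · field_simp; ring
      · rw [hψlam, hψθ]; field_simp; rw [hΦ, hφ₁, hφ₂, hφ₃]; ring
    · rw [← one_smul ℝ (1 : Matrix (Fin m) (Fin m) ℝ)]
      simp only [smul_smul, mul_one]
      apply of_coeffs
      · field_simp; rw [hA]; ring
      · rw [hψom, hψθ]; field_simp; rw [hΦ, hφ₁, hφ₂, hφ₃]; ring
  exact ⟨hmul, IsUnit.of_mul_eq_one _ hmul, inv_eq_right_inv hmul⟩
end

section
/- Suppose f₆, f₇, f₈ satisfy the system (S). Then for every t ≥ 0 one has 1 + t·f₆(t) ≠ 0 and f₈(t) = (2·f₆′(t) − f₆(t)²)/(1 + t·f₆(t)). -/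
theorem stmt12 (f₆ f₇ f₈ g₆ g₇ g₈ : ℝ → ℝ)
    (hd₆ : ∀ t ∈ Set.Ici (0 : ℝ), HasDerivWithinAt f₆ (g₆ t) (Set.Ici 0) t)
    (hd₇ : ∀ t ∈ Set.Ici (0 : ℝ), HasDerivWithinAt f₇ (g₇ t) (Set.Ici 0) t)
    (hd₈ : ∀ t ∈ Set.Ici (0 : ℝ), HasDerivWithinAt f₈ (g₈ t) (Set.Ici 0) t)
    (hc₆ : ContinuousOn g₆ (Set.Ici 0))
    (hc₇ : ContinuousOn g₇ (Set.Ici 0))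
    (hc₈ : ContinuousOn g₈ (Set.Ici 0))
    (hS₁ : ∀ t : ℝ, 0 ≤ t → t * f₆ t * f₇ t + f₇ t - f₆ t = 0)
    (hS₂ : ∀ t : ℝ, 0 ≤ t → f₆ t ^ 2 + t * f₆ t * f₈ t + f₈ t = 2 * g₆ t)
    (hS₃ : ∀ t : ℝ, 0 ≤ t → f₇ t ^ 2 + t * f₇ t * f₈ t + f₈ t = 2 * g₇ t) :
    ∀ t : ℝ, 0 ≤ t → 1 + t * f₆ t ≠ 0 ∧ f₈ t = (2 * g₆ t - f₆ t ^ 2) / (1 + t * f₆ t) := by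
  intro t ht
  have hne : 1 + t * f₆ t ≠ 0 := by
    intro h
    have hf₆ : f₆ t = 0 := by linear_combination f₇ t * h - hS₁ t ht
    simp [hf₆] at h
  refine ⟨hne, ?_⟩
  rw [eq_div_iff hne]
  linear_combination hS₂ t ht
end

section
/- Suppose f₆, f₇, f₈ satisfy the system (S). Then for every t ≥ 0 one has 4·t·f₆(t)·f₆′(t) = −2·f₆(t)² + 2·t·f₆(t)³. -/
theorem stmt13 (f₆ f₇ f₈ g₆ g₇ g₈ : ℝ → ℝ)
    (hd₆ : ∀ t ∈ Set.Ici (0 : ℝ), HasDerivWithinAt f₆ (g₆ t) (Set.Ici 0) t)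
    (hd₇ : ∀ t ∈ Set.Ici (0 : ℝ), HasDerivWithinAt f₇ (g₇ t) (Set.Ici 0) t)
    (hd₈ : ∀ t ∈ Set.Ici (0 : ℝ), HasDerivWithinAt f₈ (g₈ t) (Set.Ici 0) t)
    (hc₆ : ContinuousOn g₆ (Set.Ici 0))
    (hc₇ : ContinuousOn g₇ (Set.Ici 0))
    (hc₈ : ContinuousOn g₈ (Set.Ici 0))
    (hS₁ : ∀ t : ℝ, 0 ≤ t → t * f₆ t * f₇ t + f₇ t - f₆ t = 0)
    (hS₂ : ∀ t : ℝ, 0 ≤ t → f₆ t ^ 2 + t * f₆ t * f₈ t + f₈ t = 2 * g₆ t)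
    (hS₃ : ∀ t : ℝ, 0 ≤ t → f₇ t ^ 2 + t * f₇ t * f₈ t + f₈ t = 2 * g₇ t) :
    ∀ t : ℝ, 0 ≤ t → 4 * t * f₆ t * g₆ t = -2 * f₆ t ^ 2 + 2 * t * f₆ t ^ 3 := by
  intro t ht
  have hE := hS₁ t ht
  have h₂ := hS₂ t ht
  have h₃ := hS₃ t ht
  have hderiv := ((((hasDerivWithinAt_id t (Set.Ici 0)).mul (hd₆ t ht)).mul (hd₇ t ht)).add
    (hd₇ t ht)).sub (hd₆ t ht)
  have hzero := (hasDerivWithinAt_const t (Set.Ici (0 : ℝ)) (0 : ℝ)).congr hS₁ hE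
  have hD : (1 * f₆ t + t * g₆ t) * f₇ t + t * f₆ t * g₇ t + g₇ t - g₆ t = 0 :=
    (uniqueDiffOn_Ici (0 : ℝ) t ht).eq_deriv _ hderiv hzero
  have hg₇ : g₇ t * (1 + t * f₆ t) ^ 2 = g₆ t - f₆ t ^ 2 := by
    linear_combination (1 + t * f₆ t) * hD - (f₆ t + t * g₆ t) * hE
  have h₇ : 2 * g₇ t * (1 + t * f₆ t) ^ 2 =
      f₆ t ^ 2 + t * f₈ t * (1 + t * f₆ t) * f₆ t + f₈ t * (1 + t * f₆ t) ^ 2 := by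
    linear_combination -(1 + t * f₆ t) ^ 2 * h₃ +
      (f₇ t * (1 + t * f₆ t) + f₆ t + t * f₈ t * (1 + t * f₆ t)) * hE
  linear_combination -2 * t * f₆ t * h₂ + 2 * hg₇ - h₇ - h₂
end

section
/- Let f : [0,∞) → ℝ be a continuously differentiable function (with one-sided derivative at 0) satisfying 4·t·f(t)·f′(t) = −2·f(t)² + 2·t·f(t)³ for all t ≥ 0. Then f(t) = 0 for all t ≥ 0. -/
theorem stmt14 (f f' : ℝ → ℝ)
    (hd : ∀ t ∈ Set.Ici (0 : ℝ), HasDerivWithinAt f (f' t) (Set.Ici 0) t)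
    (hc : ContinuousOn f' (Set.Ici 0))
    (heq : ∀ t : ℝ, 0 ≤ t →
      4 * t * f t * f' t = -2 * f t ^ 2 + 2 * t * f t ^ 3) :
    ∀ t : ℝ, 0 ≤ t → f t = 0 := by
  intro T hT
  rcases hT.eq_or_lt with rfl | hT'
  · have := heq 0 le_rfl
    have h0 : f 0 ^ 2 = 0 := by linarith
    simpa using h0
  have hcont : ContinuousOn f (Set.Icc 0 T) := fun t ht =>
    ((hd t ht.1).continuousWithinAt).mono Set.Icc_subset_Ici_self
  obtain ⟨K, hK⟩ := isCompact_Icc.exists_bound_of_continuousOn hcont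
  -- The function `t * f t ^ 2` satisfies the linear equation `F' = f * F` with `F 0 = 0`.
  have hF : ∀ t ∈ Set.Ico (0 : ℝ) T,
      HasDerivWithinAt (fun t => t * f t ^ 2) (f t * (t * f t ^ 2)) (Set.Ici t) t := by
    intro t ht
    have h := ((hd t ht.1).mono (Set.Ici_subset_Ici.2 ht.1)).fun_pow 2
    refine ((hasDerivWithinAt_id t _).fun_mul h).congr_deriv ?_
    have := heq t ht.1
    simp only [id, Nat.cast_ofNat, Nat.add_one_sub_one, pow_one]
    linear_combination this / 2
  have hG := eq_zero_of_abs_deriv_le_mul_abs_self_of_eq_zero_right (K := K)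
    (continuousOn_id.fun_mul (hcont.fun_pow 2)) hF (by simp)
    (fun t ht => by
      rw [norm_mul]
      exact mul_le_mul_of_nonneg_right (hK t (Set.Ico_subset_Icc_self ht)) (norm_nonneg _))
    T (Set.right_mem_Icc.2 hT)
  simpa [hT'.ne'] using hG
end

section
/- Suppose f₆, f₇, f₈ satisfy the system (S). Then f₆(t) = f₇(t) = f₈(t) = 0 for all t ≥ 0. -/
/-- Uniqueness for the scalar linear equation `z' = a z` with zero initial value on `[0, ∞)`. -/
theorem eq_zero_of_hasDerivWithinAt_mul_self {a z : ℝ → ℝ}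
    (ha : ContinuousOn a (Set.Ici 0))
    (hz : ∀ t ∈ Set.Ici (0 : ℝ), HasDerivWithinAt z (a t * z t) (Set.Ici 0) t)
    (hz₀ : z 0 = 0) {t : ℝ} (ht : 0 ≤ t) : z t = 0 := by
  obtain ⟨K, hK⟩ := isCompact_Icc.exists_bound_of_continuousOn
    (ha.mono (Set.Icc_subset_Ici_self : Set.Icc 0 t ⊆ Set.Ici 0))
  refine eq_zero_of_abs_deriv_le_mul_abs_self_of_eq_zero_right (K := K)
    (f' := fun x => a x * z x)
    (fun x hx => ((hz x hx.1).continuousWithinAt).mono Set.Icc_subset_Ici_self)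
    (fun x hx => (hz x hx.1).mono (Set.Ici_subset_Ici.2 hx.1)) hz₀ (fun x hx => ?_)
    t (Set.right_mem_Icc.2 ht)
  rw [norm_mul]
  exact mul_le_mul_of_nonneg_right (hK x (Set.Ico_subset_Icc_self hx)) (norm_nonneg _)


theorem stmt15 (f₆ f₇ f₈ g₆ g₇ g₈ : ℝ → ℝ)
    (hd₆ : ∀ t ∈ Set.Ici (0 : ℝ), HasDerivWithinAt f₆ (g₆ t) (Set.Ici 0) t)
    (hd₇ : ∀ t ∈ Set.Ici (0 : ℝ), HasDerivWithinAt f₇ (g₇ t) (Set.Ici 0) t)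
    (hd₈ : ∀ t ∈ Set.Ici (0 : ℝ), HasDerivWithinAt f₈ (g₈ t) (Set.Ici 0) t)
    (hc₆ : ContinuousOn g₆ (Set.Ici 0))
    (hc₇ : ContinuousOn g₇ (Set.Ici 0))
    (hc₈ : ContinuousOn g₈ (Set.Ici 0))
    (hS₁ : ∀ t : ℝ, 0 ≤ t → t * f₆ t * f₇ t + f₇ t - f₆ t = 0)
    (hS₂ : ∀ t : ℝ, 0 ≤ t → f₆ t ^ 2 + t * f₆ t * f₈ t + f₈ t = 2 * g₆ t)
    (hS₃ : ∀ t : ℝ, 0 ≤ t → f₇ t ^ 2 + t * f₇ t * f₈ t + f₈ t = 2 * g₇ t) :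
    ∀ t : ℝ, 0 ≤ t → f₆ t = 0 ∧ f₇ t = 0 ∧ f₈ t = 0 := by
  have unique_deriv : ∀ t ∈ Set.Ici (0 : ℝ), UniqueDiffWithinAt ℝ (Set.Ici (0 : ℝ)) t :=
    fun t ht => uniqueDiffOn_Ici 0 t ht
  have hS₁' : ∀ t ∈ Set.Ici (0 : ℝ),
      (f₆ t + t * g₆ t) * f₇ t + t * f₆ t * g₇ t + g₇ t - g₆ t = 0 := by
    intro t ht
    have h := ((((hasDerivWithinAt_id t (Set.Ici 0)).mul (hd₆ t ht)).mul (hd₇ t ht)).add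
      (hd₇ t ht)).sub (hd₆ t ht)
    have h₀ := (hasDerivWithinAt_const t (Set.Ici (0 : ℝ)) (0 : ℝ)).congr
      (f₁ := ((id * f₆) * f₇ + f₇) - f₆) (fun x hx => hS₁ x hx) (hS₁ t ht)
    simpa using (unique_deriv t ht).eq_deriv _ h h₀
  have key : ∀ t ∈ Set.Ici (0 : ℝ), f₆ t * (f₆ t + t * (1 + t * f₆ t) * f₈ t) = 0 := by
    intro t ht
    have h₁ := hS₁ t ht
    have h₂ := hS₂ t ht
    have h₃ := hS₃ t ht
    have h₄ := hS₁' t ht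
    grind
  have hz : ∀ t ∈ Set.Ici (0 : ℝ), HasDerivWithinAt (fun t => t * f₆ t ^ 2)
      (f₆ t * (t * f₆ t ^ 2)) (Set.Ici 0) t := by
    intro t ht
    refine ((hasDerivWithinAt_id t (Set.Ici 0)).mul ((hd₆ t ht).pow 2)).congr_deriv ?_
    have h₁ := key t ht
    have h₂ := hS₂ t ht
    simp
    linear_combination h₁ - t * f₆ t * h₂
  have hf₆ : ∀ t ∈ Set.Ici (0 : ℝ), f₆ t = 0 := by
    intro t ht
    rcases eq_or_lt_of_le (show (0 : ℝ) ≤ t from ht) with rfl | hpos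
    · simpa using key 0 ht
    · have h := eq_zero_of_hasDerivWithinAt_mul_self
        (fun x hx => (hd₆ x hx).continuousWithinAt) hz (by simp) hpos.le
      simpa [hpos.ne'] using h
  intro t ht
  have hg₆ : g₆ t = 0 :=
    (unique_deriv t ht).eq_deriv _ (hd₆ t ht)
      ((hasDerivWithinAt_const t (Set.Ici (0 : ℝ)) (0 : ℝ)).congr hf₆ (hf₆ t ht))
  have h₁ := hS₁ t ht
  have h₂ := hS₂ t ht
  have h₆ := hf₆ t ht
  rw [h₆] at h₁ h₂
  exact ⟨h₆, by linarith, by linarith⟩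
end

section
/- Let m ≥ 2, let u ∈ ℝᵐ with u ≠ 0, and set t = |u|². Then the symmetric 2m×2m block matrix G = [[μ((α₁+α₃)(t),(β₁+β₃)(t),u), μ(α₂(t),β₂(t),u)], [μ(α₂(t),β₂(t),u), μ(α₁(t),β₁(t),u)]] is positive definite if and only if α₁(t) > 0, φ₁(t) > 0, α(t) > 0 and φ(t) > 0. -/
open Matrix

theorem transpose_mu {m : ℕ} (a b : ℝ) (u : Fin m → ℝ) : (mu a b u)ᵀ = mu a b u := by
  ext i j
  simp only [mu, transpose_apply, of_apply, eq_comm (a := j) (b := i)]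
  ring

theorem mu_mulVec {m : ℕ} (a b : ℝ) (u v : Fin m → ℝ) :
    mu a b u *ᵥ v = a • v + (b * (u ⬝ᵥ v)) • u := by
  have h : mu a b u = a • (1 : Matrix (Fin m) (Fin m) ℝ) + b • vecMulVec u u := by
    ext i j
    simp [mu, Matrix.one_apply, vecMulVec_apply, mul_assoc]
  rw [h, add_mulVec, smul_mulVec, one_mulVec, smul_mulVec, vecMulVec_mulVec, mul_smul]
  simp

theorem isHermitian_fromBlocks_mu {m : ℕ} (a b c d e f : ℝ) (u : Fin m → ℝ) :
    (fromBlocks (mu a b u) (mu c d u) (mu c d u) (mu e f u)).IsHermitian := by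
  simp [IsHermitian, conjTranspose_eq_transpose_of_trivial, fromBlocks_transpose, transpose_mu]

theorem dotProduct_fromBlocks_mu_mulVec {m : ℕ} (a b c d e f : ℝ) (u p q : Fin m → ℝ) :
    Sum.elim p q ⬝ᵥ
        (fromBlocks (mu a b u) (mu c d u) (mu c d u) (mu e f u) *ᵥ Sum.elim p q) =
      (a * (p ⬝ᵥ p) + 2 * c * (p ⬝ᵥ q) + e * (q ⬝ᵥ q)) +
        (b * (u ⬝ᵥ p) ^ 2 + 2 * d * ((u ⬝ᵥ p) * (u ⬝ᵥ q)) + f * (u ⬝ᵥ q) ^ 2) := by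
  rw [fromBlocks_mulVec, Sum.elim_comp_inl, Sum.elim_comp_inr, sumElim_dotProduct_sumElim]
  simp only [mu_mulVec, dotProduct_add, dotProduct_smul, smul_eq_mul]
  rw [dotProduct_comm p u, dotProduct_comm q u, dotProduct_comm q p]
  ring

/-- Orthogonal splitting of the block quadratic form along `u`. -/
theorem dotProduct_fromBlocks_mu_mulVec_eq_orthogonal_add {m : ℕ} (a b c d e f s : ℝ)
    (u p q : Fin m → ℝ) (hs : s = u ⬝ᵥ u) (hu : s ≠ 0) :
    let p' := p - ((u ⬝ᵥ p) / s) • u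
    let q' := q - ((u ⬝ᵥ q) / s) • u
    Sum.elim p q ⬝ᵥ
        (fromBlocks (mu a b u) (mu c d u) (mu c d u) (mu e f u) *ᵥ Sum.elim p q) =
      (a * (p' ⬝ᵥ p') + 2 * c * (p' ⬝ᵥ q') + e * (q' ⬝ᵥ q')) +
        ((a + s * b) * (u ⬝ᵥ p) ^ 2 + 2 * (c + s * d) * ((u ⬝ᵥ p) * (u ⬝ᵥ q)) +
          (e + s * f) * (u ⬝ᵥ q) ^ 2) / s := by
  intro p' q'
  rw [dotProduct_fromBlocks_mu_mulVec]
  simp only [p', q', dotProduct_sub, sub_dotProduct, dotProduct_smul, smul_dotProduct, smul_eq_mul,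
    ← hs, dotProduct_comm p u, dotProduct_comm q u]
  field_simp
  ring

theorem mul_dotProduct_form {ι : Type*} [Fintype ι] (a b c : ℝ) (p q : ι → ℝ) :
    c * (a * (p ⬝ᵥ p) + 2 * b * (p ⬝ᵥ q) + c * (q ⬝ᵥ q)) =
      (c * a - b ^ 2) * (p ⬝ᵥ p) + (b • p + c • q) ⬝ᵥ (b • p + c • q) := by
  simp only [dotProduct_add, add_dotProduct, dotProduct_smul, smul_dotProduct, smul_eq_mul,
    dotProduct_comm q p]
  ring

theorem dotProduct_form_nonneg {ι : Type*} [Fintype ι] {a b c : ℝ} (hc : 0 < c)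
    (hd : 0 < c * a - b ^ 2) (p q : ι → ℝ) :
    0 ≤ a * (p ⬝ᵥ p) + 2 * b * (p ⬝ᵥ q) + c * (q ⬝ᵥ q) := by
  have h := mul_dotProduct_form a b c p q
  have h₁ : 0 ≤ p ⬝ᵥ p := by simpa using dotProduct_star_self_nonneg p
  have h₂ : 0 ≤ (b • p + c • q) ⬝ᵥ (b • p + c • q) := by
    simpa using dotProduct_star_self_nonneg (b • p + c • q)
  exact nonneg_of_mul_nonneg_right (h ▸ by positivity) hc

theorem eq_zero_of_dotProduct_form_eq_zero {ι : Type*} [Fintype ι] {a b c : ℝ} (hc : 0 < c)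
    (hd : 0 < c * a - b ^ 2) {p q : ι → ℝ}
    (h0 : a * (p ⬝ᵥ p) + 2 * b * (p ⬝ᵥ q) + c * (q ⬝ᵥ q) = 0) : p = 0 ∧ q = 0 := by
  have h := mul_dotProduct_form a b c p q
  have h₁ : 0 ≤ p ⬝ᵥ p := by simpa using dotProduct_star_self_nonneg p
  have h₂ : 0 ≤ (b • p + c • q) ⬝ᵥ (b • p + c • q) := by
    simpa using dotProduct_star_self_nonneg (b • p + c • q)
  have hp : p = 0 := by
    rw [h0, mul_zero] at h
    refine dotProduct_self_eq_zero.1 (le_antisymm ?_ h₁)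
    by_contra! hlt
    linarith [mul_pos hd hlt]
  subst hp
  simpa [hc.ne'] using h0

theorem binary_form_nonneg {a b c : ℝ} (hc : 0 < c) (hd : 0 < c * a - b ^ 2) (x y : ℝ) :
    0 ≤ a * x ^ 2 + 2 * b * (x * y) + c * y ^ 2 := by
  simpa [dotProduct, sq] using dotProduct_form_nonneg hc hd (fun _ : Unit => x) (fun _ => y)

theorem eq_zero_of_binary_form_eq_zero {a b c : ℝ} (hc : 0 < c) (hd : 0 < c * a - b ^ 2) {x y : ℝ}
    (h0 : a * x ^ 2 + 2 * b * (x * y) + c * y ^ 2 = 0) : x = 0 ∧ y = 0 := by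
  have h := eq_zero_of_dotProduct_form_eq_zero hc hd (p := fun _ : Unit => x) (q := fun _ => y)
    (by simpa [dotProduct, sq] using h0)
  exact ⟨congrFun h.1 (), congrFun h.2 ()⟩

theorem pos_of_binary_form_pos {a b c : ℝ}
    (h : ∀ x y : ℝ, (x ≠ 0 ∨ y ≠ 0) → 0 < a * x ^ 2 + 2 * b * (x * y) + c * y ^ 2) :
    0 < c ∧ 0 < c * a - b ^ 2 := by
  have hc : 0 < c := by simpa using h 0 1 (by simp)
  refine ⟨hc, pos_of_mul_pos_right (a := c) ?_ hc.le⟩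
  calc 0 < a * c ^ 2 + 2 * b * (c * -b) + c * (-b) ^ 2 := h c (-b) (Or.inl hc.ne')
    _ = c * (c * a - b ^ 2) := by ring

theorem stmt16 (m : ℕ) (hm : 2 ≤ m) (α₁ α₂ α₃ β₁ β₂ β₃ : ℝ → ℝ)
    (u : Fin m → ℝ) (hu : u ≠ 0) (t : ℝ) (ht : t = ∑ i, u i ^ 2)
    (φ₁ φ₂ φ₃ A Φ : ℝ)
    (hφ₁ : φ₁ = α₁ t + t * β₁ t) (hφ₂ : φ₂ = α₂ t + t * β₂ t)
    (hφ₃ : φ₃ = α₃ t + t * β₃ t)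
    (hA : A = α₁ t * (α₁ t + α₃ t) - α₂ t ^ 2)
    (hΦ : Φ = φ₁ * (φ₁ + φ₃) - φ₂ ^ 2)
    (G : Matrix (Fin m ⊕ Fin m) (Fin m ⊕ Fin m) ℝ)
    (hG : G = Matrix.fromBlocks
      (mu (α₁ t + α₃ t) (β₁ t + β₃ t) u) (mu (α₂ t) (β₂ t) u)
      (mu (α₂ t) (β₂ t) u) (mu (α₁ t) (β₁ t) u)) :
    G.PosDef ↔ (0 < α₁ t ∧ 0 < φ₁ ∧ 0 < A ∧ 0 < Φ) := by
  have ht' : t = u ⬝ᵥ u := by simp [ht, dotProduct, sq]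
  have ht0 : 0 < t := by
    rw [ht']
    simpa using dotProduct_star_self_pos_iff.2 hu
  subst hG hφ₁ hφ₂ hφ₃ hA hΦ
  rw [posDef_iff_dotProduct_mulVec]
  constructor
  · rintro ⟨-, hpos⟩
    have key : ∀ p q : Fin m → ℝ, (p ≠ 0 ∨ q ≠ 0) → 0 <
        ((α₁ t + α₃ t) * (p ⬝ᵥ p) + 2 * α₂ t * (p ⬝ᵥ q) + α₁ t * (q ⬝ᵥ q)) +
        ((β₁ t + β₃ t) * (u ⬝ᵥ p) ^ 2 + 2 * β₂ t * ((u ⬝ᵥ p) * (u ⬝ᵥ q)) +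
          β₁ t * (u ⬝ᵥ q) ^ 2) := by
      intro p q hpq
      rw [← dotProduct_fromBlocks_mu_mulVec]
      refine hpos (x := Sum.elim p q) fun h => ?_
      rcases hpq with hp | hq
      · exact hp (funext fun i => congrFun h (Sum.inl i))
      · exact hq (funext fun i => congrFun h (Sum.inr i))
    have : Nontrivial (Fin m) := Fin.nontrivial_iff_two_le.2 hm
    obtain ⟨v, hv, huv⟩ := exists_ne_zero_dotProduct_eq_zero u
    rw [dotProduct_comm] at huv
    have hvv : 0 < v ⬝ᵥ v := by simpa using dotProduct_star_self_pos_iff.2 hv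
    have hα : 0 < α₁ t ∧ 0 < α₁ t * (α₁ t + α₃ t) - α₂ t ^ 2 := by
      refine pos_of_binary_form_pos fun x y hxy => ?_
      have h := key (x • v) (y • v) (by simpa [hv] using hxy)
      simp only [dotProduct_smul, smul_dotProduct, smul_eq_mul, huv] at h
      refine pos_of_mul_pos_right (a := v ⬝ᵥ v) ?_ hvv.le
      linear_combination h
    have hφ : 0 < α₁ t + t * β₁ t ∧ 0 < (α₁ t + t * β₁ t) *
        (α₁ t + t * β₁ t + (α₃ t + t * β₃ t)) - (α₂ t + t * β₂ t) ^ 2 := by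
      refine pos_of_binary_form_pos fun x y hxy => ?_
      have h := key (x • u) (y • u) (by simpa [hu] using hxy)
      simp only [dotProduct_smul, smul_dotProduct, smul_eq_mul, ← ht'] at h
      refine pos_of_mul_pos_right (a := t) ?_ ht0.le
      linear_combination h
    exact ⟨hα.1, hφ.1, hα.2, hφ.2⟩
  · rintro ⟨hα, hφ, hA, hΦ⟩
    refine ⟨isHermitian_fromBlocks_mu .., fun z hz => ?_⟩
    obtain ⟨p, q, rfl⟩ : ∃ p q : Fin m → ℝ, z = Sum.elim p q :=
      ⟨z ∘ Sum.inl, z ∘ Sum.inr, (Sum.elim_comp_inl_inr z).symm⟩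
    replace hΦ : 0 < (α₁ t + t * β₁ t) * (α₁ t + α₃ t + t * (β₁ t + β₃ t)) -
        (α₂ t + t * β₂ t) ^ 2 := by
      linear_combination hΦ
    rw [star_trivial, dotProduct_fromBlocks_mu_mulVec_eq_orthogonal_add _ _ _ _ _ _ t u p q ht'
      ht0.ne']
    have h₁ := dotProduct_form_nonneg hα hA (p - ((u ⬝ᵥ p) / t) • u) (q - ((u ⬝ᵥ q) / t) • u)
    have h₂ := div_nonneg (binary_form_nonneg hφ hΦ (u ⬝ᵥ p) (u ⬝ᵥ q)) ht0.le
    refine (add_nonneg h₁ h₂).lt_of_ne' fun h => hz ?_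
    obtain ⟨e₁, e₂⟩ := (add_eq_zero_iff_of_nonneg h₁ h₂).1 h
    obtain ⟨hx, hy⟩ := eq_zero_of_binary_form_eq_zero hφ hΦ
      ((div_eq_zero_iff.1 e₂).resolve_right ht0.ne')
    obtain ⟨hp, hq⟩ := eq_zero_of_dotProduct_form_eq_zero hα hA e₁
    rw [hx, zero_div, zero_smul, sub_zero] at hp
    rw [hy, zero_div, zero_smul, sub_zero] at hq
    simp [hp, hq]
end
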